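/- Equality of rotation numbers on a monotone set: If M ⊆ A is a monotone set, and z₁, z₂ ∈ A are points whose extended orbits EO(z₁) and EO(z₂) are both contained in M, then the rotation numbers ρ(z₁) = lim_{n→∞} π_x(fⁿ(z₁))/n and ρ(z₂) = lim_{n→∞} π_x(fⁿ(z₂))/n exist and are equal. -/

import Mathlib

open Set Filter Topology

noncomputable section

/-- The closed annulus `A = ℝ × [0,1]` (universal cover of `𝕋¹ × [0,1]`). -/
def Ann : Set (ℝ × ℝ) := {p | p.2 ∈ Set.Icc (0:ℝ) 1}

/-- An area-preserving positive monotone twist map of the annulus, given together with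
its inverse, as a lift to the universal cover `A = ℝ × [0,1]`. -/
structure AnnulusTwistMap where
  f : ℝ × ℝ → ℝ × ℝ
  finv : ℝ × ℝ → ℝ × ℝ
  smooth : ContDiffOn ℝ 1 f Ann
  smooth_inv : ContDiffOn ℝ 1 finv Ann
  maps : Set.MapsTo f Ann Ann
  maps_inv : Set.MapsTo finv Ann Ann
  left_inv : ∀ p ∈ Ann, finv (f p) = p
  right_inv : ∀ p ∈ Ann, f (finv p) = p
  lift : ∀ p ∈ Ann, f (p.1 + 1, p.2) = f p + (1, 0)
  orient : ∀ p ∈ Ann, 0 < LinearMap.det ((fderivWithin ℝ f Ann p).toLinearMap)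
  bottom : ∀ x : ℝ, (f (x, 0)).2 = 0
  top : ∀ x : ℝ, (f (x, 1)).2 = 1
  area : ∀ s ⊆ Ann, MeasurableSet s → MeasureTheory.volume (f '' s) = MeasureTheory.volume s
  twist : ∀ p ∈ Ann, 0 < derivWithin (fun y => (f (p.1, y)).1) (Set.Icc (0:ℝ) 1) p.2

/-- The graph `{(x, φ(x)) : x ∈ ℝ}` of a function `φ`. -/
def torusGraph (φ : ℝ → ℝ) : Set (ℝ × ℝ) := {p | p.2 = φ p.1}

/-- `φ` defines an invariant primary torus (essential invariant circle) for `F`. -/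
def IsPrimaryTorusFn (F : AnnulusTwistMap) (φ : ℝ → ℝ) : Prop :=
  (∃ K, LipschitzWith K φ) ∧ (∀ x, φ x ∈ Set.Icc (0:ℝ) 1) ∧ (∀ x, φ (x + 1) = φ x) ∧
    F.f '' torusGraph φ = torusGraph φ

/-- `T` is an invariant primary torus for `F`. -/
def IsPrimaryTorus (F : AnnulusTwistMap) (T : Set (ℝ × ℝ)) : Prop :=
  ∃ φ, IsPrimaryTorusFn F φ ∧ T = torusGraph φ

/-- The closed region between the graphs of `φ₁` and `φ₂`. -/
def zone (φ₁ φ₂ : ℝ → ℝ) : Set (ℝ × ℝ) := {p | φ₁ p.1 ≤ p.2 ∧ p.2 ≤ φ₂ p.1}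

/-- The open region strictly between the graphs of `φ₁` and `φ₂` (the interior of the zone). -/
def zoneInterior (φ₁ φ₂ : ℝ → ℝ) : Set (ℝ × ℝ) := {p | φ₁ p.1 < p.2 ∧ p.2 < φ₂ p.1}

/-- The region between the invariant primary tori `graph φ₁` and `graph φ₂` is a
Birkhoff Zone of Instability. -/
def IsBZI (F : AnnulusTwistMap) (φ₁ φ₂ : ℝ → ℝ) : Prop :=
  IsPrimaryTorusFn F φ₁ ∧ IsPrimaryTorusFn F φ₂ ∧ (∀ x, φ₁ x < φ₂ x) ∧
    ∀ T, IsPrimaryTorus F T → ¬ T ⊆ zoneInterior φ₁ φ₂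

/-- `z` has rotation number `ω`. -/
def HasRotNum (F : AnnulusTwistMap) (z : ℝ × ℝ) (ω : ℝ) : Prop :=
  Filter.Tendsto (fun n : ℕ => ((F.f)^[n] z).1 / n) Filter.atTop (nhds ω)

/-- The `n`-th iterate of `F` for `n : ℤ`. -/
def iterZ (F : AnnulusTwistMap) (n : ℤ) (z : ℝ × ℝ) : ℝ × ℝ :=
  if 0 ≤ n then (F.f)^[n.toNat] z else (F.finv)^[(-n).toNat] z

/-- The extended orbit `EO(z) = {fⁿ(z) + (j,0) : n, j ∈ ℤ}`. -/
def extOrbit (F : AnnulusTwistMap) (z : ℝ × ℝ) : Set (ℝ × ℝ) :=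
  {w | ∃ n j : ℤ, w = iterZ F n z + ((j : ℝ), 0)}

/-- A monotone (cyclically ordered) set. -/
def IsMonotoneSet (F : AnnulusTwistMap) (M : Set (ℝ × ℝ)) : Prop :=
  ∀ z₁ ∈ M, ∀ z₂ ∈ M, z₁.1 < z₂.1 → (F.f z₁).1 < (F.f z₂).1

/-- An Aubry-Mather set of rotation number `ω`: a nonempty, closed, invariant, monotone,
minimal subset of `Rot(ω)`. -/
def IsAubryMather (F : AnnulusTwistMap) (ω : ℝ) (S : Set (ℝ × ℝ)) : Prop :=
  S.Nonempty ∧ IsClosed S ∧ F.f '' S = S ∧ IsMonotoneSet F S ∧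
    (∀ z ∈ S, HasRotNum F z ω) ∧
    ∀ S' ⊆ S, S'.Nonempty → IsClosed S' → F.f '' S' = S' → S' = S

/-- A real sequence whose additivity defect is bounded grows linearly. -/
theorem exists_tendsto_div_of_abs_sub_sub_le {a : ℕ → ℝ} {C : ℝ}
    (h : ∀ m n, |a (m + n) - a m - a n| ≤ C) :
    ∃ ω, Tendsto (fun n : ℕ => a n / n) atTop (𝓝 ω) := by
  have hsub : Subadditive (fun n => a n + C) := fun m n => by
    linarith [(abs_le.mp (h m n)).2]
  have hlower : ∀ n : ℕ, n * (a 1 - C) ≤ a n + C := by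
    intro n
    induction n with
    | zero =>
      have := (abs_le.mp (h 0 0)).2
      simp only [Nat.add_zero] at this
      simp only [Nat.cast_zero, zero_mul]
      linarith
    | succ k ih =>
      have := (abs_le.mp (h k 1)).1
      push_cast
      linarith
  have hbdd : BddBelow (range fun n : ℕ => (a n + C) / n) := by
    refine ⟨min 0 (a 1 - C), ?_⟩
    rintro _ ⟨n, rfl⟩
    rcases Nat.eq_zero_or_pos n with rfl | hn
    · simp
    · have hn' : (0 : ℝ) < n := by exact_mod_cast hn
      refine (min_le_right _ _).trans ?_
      rw [le_div_iff₀ hn']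
      linarith [hlower n]
  refine ⟨hsub.lim, ?_⟩
  have := (hsub.tendsto_lim hbdd).sub (tendsto_const_div_atTop_nhds_zero_nat C)
  simpa [add_div] using this

theorem add_intCast_mem_Ann {p : ℝ × ℝ} (hp : p ∈ Ann) (j : ℤ) : p + ((j : ℝ), 0) ∈ Ann := by
  simpa [Ann] using hp

theorem AnnulusTwistMap.map_add_intCast (F : AnnulusTwistMap) (j : ℤ) :
    ∀ p ∈ Ann, F.f (p + ((j : ℝ), 0)) = F.f p + ((j : ℝ), 0) := by
  have one : ∀ p ∈ Ann, F.f (p + (1, 0)) = F.f p + (1, 0) := fun p hp => by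
    rw [← F.lift p hp]
    congr 1
    ext <;> simp
  induction j with
  | zero => intro p _; simp [← Prod.zero_eq_mk]
  | succ k ih =>
    intro p hp
    have e : ∀ q : ℝ × ℝ, q + (((k + 1 : ℤ) : ℝ), 0) = q + (((k : ℤ) : ℝ), 0) + (1, 0) := by
      intro q; ext <;> simp [add_assoc]
    rw [e, one _ (add_intCast_mem_Ann hp _), ih p hp, e]
  | pred k ih =>
    intro p hp
    have e : ∀ q : ℝ × ℝ,
        q + (((-k - 1 : ℤ) : ℝ), 0) + (1, 0) = q + (((-k : ℤ) : ℝ), 0) := by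
      intro q; ext <;> simp [add_assoc]
    have := one _ (add_intCast_mem_Ann hp (-k - 1))
    rw [e, ih p hp, ← e] at this
    exact (add_right_cancel this).symm

theorem AnnulusTwistMap.iterate_add_intCast (F : AnnulusTwistMap) (j : ℤ) (n : ℕ)
    {p : ℝ × ℝ} (hp : p ∈ Ann) :
    F.f^[n] (p + ((j : ℝ), 0)) = F.f^[n] p + ((j : ℝ), 0) := by
  induction n with
  | zero => rfl
  | succ n ih =>
    rw [Function.iterate_succ_apply', Function.iterate_succ_apply', ih,
      F.map_add_intCast j _ (F.maps.iterate n hp)]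

theorem iterate_add_intCast_mem_extOrbit (F : AnnulusTwistMap) (z : ℝ × ℝ) (n : ℕ) (j : ℤ) :
    F.f^[n] z + ((j : ℝ), 0) ∈ extOrbit F z :=
  ⟨n, j, by simp [iterZ]⟩

/-- Iterates of `F` preserve the horizontal order of two points whose translated forward orbits
lie in a monotone set. -/
theorem IsMonotoneSet.iterate_fst_lt {F : AnnulusTwistMap} {M : Set (ℝ × ℝ)}
    (hM : IsMonotoneSet F M) {p q : ℝ × ℝ} (hp : ∀ n : ℕ, F.f^[n] p ∈ M)
    (hq : ∀ n : ℕ, F.f^[n] q ∈ M) (h : p.1 < q.1) (n : ℕ) :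
    (F.f^[n] p).1 < (F.f^[n] q).1 := by
  induction n with
  | zero => exact h
  | succ n ih =>
    rw [Function.iterate_succ_apply', Function.iterate_succ_apply']
    exact hM _ (hp n) _ (hq n) ih

/-- Horizontal distances between orbits in a monotone set stay below any integer bound that
holds initially. -/
theorem IsMonotoneSet.abs_iterate_fst_sub_lt {F : AnnulusTwistMap} {M : Set (ℝ × ℝ)}
    (hM : IsMonotoneSet F M) {p q : ℝ × ℝ} (hpA : p ∈ Ann)
    (hp : ∀ (n : ℕ) (j : ℤ), F.f^[n] p + ((j : ℝ), 0) ∈ M) (hq : ∀ n : ℕ, F.f^[n] q ∈ M)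
    {k : ℤ} (h : |p.1 - q.1| < k) (n : ℕ) :
    |(F.f^[n] p).1 - (F.f^[n] q).1| < k := by
  have hp' : ∀ (j : ℤ) (n : ℕ), F.f^[n] (p + ((j : ℝ), 0)) ∈ M := fun j n => by
    rw [F.iterate_add_intCast j n hpA]
    exact hp n j
  rw [abs_lt] at h ⊢
  have h₁ := hM.iterate_fst_lt (hp' (-k)) hq
    (by simp only [Prod.fst_add, Int.cast_neg]; linarith) n
  have h₂ := hM.iterate_fst_lt hq (hp' k) (by simp only [Prod.fst_add]; linarith) n
  rw [F.iterate_add_intCast _ n hpA, Prod.fst_add] at h₁ h₂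
  push_cast at h₁
  constructor <;> linarith

/-- The rotation number of a point whose extended orbit lies in a monotone set exists. -/
theorem IsMonotoneSet.exists_hasRotNum {F : AnnulusTwistMap} {M : Set (ℝ × ℝ)}
    (hM : IsMonotoneSet F M) {z : ℝ × ℝ} (hz : z ∈ Ann) (h : extOrbit F z ⊆ M) :
    ∃ ω, HasRotNum F z ω := by
  have hmem : ∀ (n : ℕ) (j : ℤ), F.f^[n] z + ((j : ℝ), 0) ∈ M := fun n j =>
    h (iterate_add_intCast_mem_extOrbit F z n j)
  have hmem₀ : ∀ n : ℕ, F.f^[n] z ∈ M := fun n => by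
    simpa [← Prod.zero_eq_mk] using hmem n 0
  refine exists_tendsto_div_of_abs_sub_sub_le (C := 4 + |z.1|) fun m n => ?_
  obtain ⟨j, hj⟩ : ∃ j : ℤ, j = ⌊z.1 - (F.f^[n] z).1⌋ := ⟨_, rfl⟩
  have hj₁ := Int.floor_le (z.1 - (F.f^[n] z).1)
  have hj₂ := Int.lt_floor_add_one (z.1 - (F.f^[n] z).1)
  rw [← hj] at hj₁ hj₂
  have hnA : F.f^[n] z ∈ Ann := F.maps.iterate n hz
  have hw : ∀ i : ℕ, F.f^[i] (F.f^[n] z + ((j : ℝ), 0)) ∈ M := fun i => by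
    rw [F.iterate_add_intCast j i hnA, ← Function.iterate_add_apply]
    exact hmem (i + n) j
  have key := hM.abs_iterate_fst_sub_lt (k := 2) hz hmem hw
    (by rw [abs_lt, Prod.fst_add]; push_cast; constructor <;> linarith) m
  rw [F.iterate_add_intCast j m hnA, ← Function.iterate_add_apply, Prod.fst_add, abs_lt] at key
  push_cast at key
  have hz₁ := neg_abs_le z.1
  have hz₂ := le_abs_self z.1
  rw [abs_le]
  constructor <;> linarith [key.1, key.2]

/-- **Equality of rotation numbers on a monotone set**: if `M` is a monotone set and the
extended orbits of `z₁` and `z₂` are both contained in `M`, then the rotation numbers of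
`z₁` and `z₂` exist and are equal. -/
theorem rotation_numbers_equal_on_monotone_set (F : AnnulusTwistMap)
    (M : Set (ℝ × ℝ)) (hmono : IsMonotoneSet F M)
    (z₁ z₂ : ℝ × ℝ) (hz₁ : z₁ ∈ Ann) (hz₂ : z₂ ∈ Ann)
    (h₁ : extOrbit F z₁ ⊆ M) (h₂ : extOrbit F z₂ ⊆ M) :
    ∃ ω : ℝ, HasRotNum F z₁ ω ∧ HasRotNum F z₂ ω := by
  obtain ⟨ω, hω⟩ := hmono.exists_hasRotNum hz₁ h₁
  refine ⟨ω, hω, ?_⟩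
  obtain ⟨k, hk⟩ := exists_nat_gt |z₁.1 - z₂.1|
  have hdist := hmono.abs_iterate_fst_sub_lt (k := k) hz₁
    (fun n j => h₁ (iterate_add_intCast_mem_extOrbit F z₁ n j))
    (fun n => by
      simpa [← Prod.zero_eq_mk] using h₂ (iterate_add_intCast_mem_extOrbit F z₂ n 0))
    (by exact_mod_cast hk)
  have hdiff : Tendsto (fun n : ℕ => ((F.f^[n] z₁).1 - (F.f^[n] z₂).1) / n) atTop (𝓝 0) := by
    refine squeeze_zero_norm (fun n => ?_) (tendsto_const_div_atTop_nhds_zero_nat (k : ℝ))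
    rw [Real.norm_eq_abs, abs_div, Nat.abs_cast]
    gcongr
    exact_mod_cast (hdist n).le
  have := Tendsto.sub hω hdiff
  simpa only [HasRotNum, sub_div, sub_sub_cancel, sub_zero] using this
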